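/- arXiv:math/0101240 — 2 statements merged into one kernel-verified Lean document; each statement's English description precedes it below -/
import Mathlib

section
/- Let k ≥ 1, ε₀ > 0, C > 0, a > 0, and for each n ∈ ℕ let A_n : ℂ^k → ℂ^k be a linear map with ‖A_n‖ ≤ a and F_n : B(0,ε₀) → ℂ^k a map with F_n(0) = 0 and |F_n(v) − A_n v| ≤ C|v|² for all |v| < ε₀. Set L := limsup_{N→∞} sup_n (1/N)·log‖A_n^{(N)}‖ and assume L < 0. Then for every δ > 0 with L + δ < 0 there exist ε ∈ (0, ε₀) and C' ≥ 1 such that for every n ∈ ℕ, every v with |v| ≤ ε, and every N ≥ 0, all intermediate iterates F_n^{(j)}(v) (0 ≤ j ≤ N) are defined and lie in B(0,ε₀), and |F_n^{(N)}(v)| ≤ C'·e^{(L+δ)N}·|v|. -/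
open Metric Filter

noncomputable section

/-- `G_n^{(N)} = G_{n+N−1} ∘ ⋯ ∘ G_{n+1} ∘ G_n`, the composition of `N` consecutive
maps of the sequence `G` starting at index `n` (`= id` for `N = 0`). -/
def seqComp {X : Type*} (G : ℕ → X → X) (n : ℕ) : ℕ → X → X
  | 0 => id
  | N + 1 => G (n + N) ∘ seqComp G n N

/-- The composition `A_{n+N−1} ∘ ⋯ ∘ A_n` of continuous linear maps. -/
def prodCLM {E : Type*} [NormedAddCommGroup E] [NormedSpace ℂ E]
    (A : ℕ → E →L[ℂ] E) (n : ℕ) : ℕ → E →L[ℂ] E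
  | 0 => ContinuousLinearMap.id ℂ E
  | N + 1 => (A (n + N)).comp (prodCLM A n N)

section

variable {E : Type*} [NormedAddCommGroup E] [NormedSpace ℂ E]

lemma prodCLM_succ_apply (A : ℕ → E →L[ℂ] E) (n j : ℕ) (v : E) :
    prodCLM A n (j + 1) v = prodCLM A (n + 1) j (A n v) := by
  induction j with
  | zero => simp [prodCLM]
  | succ j ih =>
    calc prodCLM A n (j + 1 + 1) v = A (n + (j + 1)) (prodCLM A n (j + 1) v) := rfl
      _ = A (n + 1 + j) (prodCLM A (n + 1) j (A n v)) := by
        rw [ih, Nat.add_right_comm, Nat.add_assoc]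
      _ = prodCLM A (n + 1) (j + 1) (A n v) := rfl

lemma norm_prodCLM_apply_le {A : ℕ → E →L[ℂ] E} {a : ℝ} (hA : ∀ n, ‖A n‖ ≤ a)
    (n j : ℕ) (v : E) : ‖prodCLM A n j v‖ ≤ a ^ j * ‖v‖ := by
  have ha : 0 ≤ a := (norm_nonneg _).trans (hA 0)
  induction j with
  | zero => simp [prodCLM]
  | succ j ih =>
    calc ‖prodCLM A n (j + 1) v‖ = ‖A (n + j) (prodCLM A n j v)‖ := rfl
      _ ≤ a * ‖prodCLM A n j v‖ := (A (n + j)).le_of_opNorm_le (hA _) _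
      _ ≤ a * (a ^ j * ‖v‖) := by gcongr
      _ = a ^ (j + 1) * ‖v‖ := by ring

/-- The adapted (Lyapunov) norm at time `n` with rate `lam`, built from `M` consecutive
iterates. -/
def adaptedNorm (A : ℕ → E →L[ℂ] E) (lam : ℝ) (M n : ℕ) (v : E) : ℝ :=
  ∑ j ∈ Finset.range M, Real.exp (-(lam * j)) * ‖prodCLM A n j v‖

lemma adaptedNorm_add_le (A : ℕ → E →L[ℂ] E) (lam : ℝ) (M n : ℕ) (v w : E) :
    adaptedNorm A lam M n (v + w) ≤ adaptedNorm A lam M n v + adaptedNorm A lam M n w := by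
  unfold adaptedNorm
  rw [← Finset.sum_add_distrib]
  refine Finset.sum_le_sum fun j _ => ?_
  rw [← mul_add, map_add]
  gcongr
  exact norm_add_le _ _

lemma norm_le_adaptedNorm (A : ℕ → E →L[ℂ] E) (lam : ℝ) {M : ℕ} (hM : 0 < M) (n : ℕ)
    (v : E) : ‖v‖ ≤ adaptedNorm A lam M n v := by
  have h := Finset.single_le_sum (f := fun j : ℕ => Real.exp (-(lam * j)) * ‖prodCLM A n j v‖)
    (fun j _ => by positivity) (Finset.mem_range.2 hM)
  simpa [prodCLM, adaptedNorm] using h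

lemma adaptedNorm_le {A : ℕ → E →L[ℂ] E} {a : ℝ} (hA : ∀ n, ‖A n‖ ≤ a) (lam : ℝ) (M n : ℕ)
    (v : E) : adaptedNorm A lam M n v ≤
      (∑ j ∈ Finset.range M, Real.exp (-(lam * j)) * a ^ j) * ‖v‖ := by
  unfold adaptedNorm
  rw [Finset.sum_mul]
  refine Finset.sum_le_sum fun j _ => ?_
  rw [mul_assoc]
  gcongr
  exact norm_prodCLM_apply_le hA n j v

lemma adaptedNorm_map_eq (A : ℕ → E →L[ℂ] E) (lam : ℝ) (M n : ℕ) (v : E) :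
    adaptedNorm A lam M (n + 1) (A n v) = Real.exp lam *
      (adaptedNorm A lam M n v - ‖v‖ + Real.exp (-(lam * M)) * ‖prodCLM A n M v‖) := by
  have h := Finset.sum_range_succ
    (fun j : ℕ => Real.exp (-(lam * j)) * ‖prodCLM A n j v‖) M
  rw [Finset.sum_range_succ'] at h
  have h0 : Real.exp (-(lam * (0 : ℕ))) * ‖prodCLM A n 0 v‖ = ‖v‖ := by simp [prodCLM]
  have h1 : adaptedNorm A lam M (n + 1) (A n v) = Real.exp lam *
      ∑ j ∈ Finset.range M, Real.exp (-(lam * (j + 1 : ℕ))) * ‖prodCLM A n (j + 1) v‖ := by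
    unfold adaptedNorm
    rw [Finset.mul_sum]
    refine Finset.sum_congr rfl fun j _ => ?_
    rw [prodCLM_succ_apply, ← mul_assoc, ← Real.exp_add]
    congr 2
    push_cast
    ring
  rw [h1]
  congr 1
  unfold adaptedNorm
  linarith

lemma adaptedNorm_map_le {A : ℕ → E →L[ℂ] E} {lam b : ℝ} {M n : ℕ}
    (hb : ‖prodCLM A n M‖ ≤ Real.exp (M * b)) (v : E) :
    adaptedNorm A lam M (n + 1) (A n v) ≤ Real.exp lam *
      (adaptedNorm A lam M n v - (1 - Real.exp (M * (b - lam))) * ‖v‖) := by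
  have h : Real.exp (-(lam * M)) * ‖prodCLM A n M v‖ ≤ Real.exp (M * (b - lam)) * ‖v‖ :=
    calc Real.exp (-(lam * M)) * ‖prodCLM A n M v‖
        ≤ Real.exp (-(lam * M)) * (Real.exp (M * b) * ‖v‖) := by
          gcongr
          exact (prodCLM A n M).le_of_opNorm_le hb v
      _ = Real.exp (M * (b - lam)) * ‖v‖ := by
          rw [← mul_assoc, ← Real.exp_add]
          ring_nf
  rw [adaptedNorm_map_eq]
  gcongr
  linarith

/-- A negative upper bound on the real-valued supremum of exponential growth rates bounds
the operator norms. -/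
lemma norm_le_exp_of_iSup_le {ι : Type*} {P : ι → E →L[ℂ] E} {M : ℕ} (hM : 0 < M) {b : ℝ}
    (hb : b < 0) (h : ⨆ i, (1 / (M : ℝ)) * Real.log ‖P i‖ ≤ b) (i : ι) :
    ‖P i‖ ≤ Real.exp (M * b) := by
  have hbdd : BddAbove (Set.range fun i => (1 / (M : ℝ)) * Real.log ‖P i‖) := by
    by_contra hn
    rw [Real.iSup_of_not_bddAbove hn] at h
    exact hb.not_ge h
  have hi := (le_ciSup hbdd i).trans h
  have hM' : (0 : ℝ) < M := Nat.cast_pos.2 hM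
  rw [one_div, inv_mul_le_iff₀ hM'] at hi
  exact (Real.le_exp_log _).trans (Real.exp_le_exp.2 hi)

lemma exists_eventually_le_of_limsup_lt {u : ℕ → ℝ} {c : ℝ} (hneg : limsup u atTop < 0)
    (hc : limsup u atTop < c) : ∃ b < c, ∀ᶠ N in atTop, u N ≤ b := by
  rw [limsup_eq] at hneg hc
  have hne : {b : ℝ | ∀ᶠ N in atTop, u N ≤ b}.Nonempty := by
    by_contra hn
    rw [Set.not_nonempty_iff_eq_empty.1 hn, Real.sInf_empty] at hneg
    exact lt_irrefl _ hneg
  obtain ⟨b, hb, hbc⟩ := exists_lt_of_csInf_lt hne hc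
  exact ⟨b, hbc, hb⟩

end

/-- Non-uniform contraction estimate.  With
`L := limsup_N sup_n (1/N)·log‖A_n^{(N)}‖ < 0`, for every `δ > 0` with `L + δ < 0`
there are `ε ∈ (0, ε₀)` and `C' ≥ 1` such that for all `n`, all `|v| ≤ ε` and all
`N ≥ 0` the intermediate iterates `F_n^{(j)}(v)`, `0 ≤ j ≤ N`, all lie in `B(0,ε₀)`,
and `|F_n^{(N)}(v)| ≤ C'·e^{(L+δ)N}·|v|`. -/
theorem stmt1 (k : ℕ) (hk : 1 ≤ k) (ε₀ C a : ℝ) (hε₀ : 0 < ε₀) (hC : 0 < C) (ha : 0 < a)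
    (A : ℕ → EuclideanSpace ℂ (Fin k) →L[ℂ] EuclideanSpace ℂ (Fin k))
    (hA : ∀ n, ‖A n‖ ≤ a)
    (F : ℕ → EuclideanSpace ℂ (Fin k) → EuclideanSpace ℂ (Fin k))
    (hF0 : ∀ n, F n 0 = 0)
    (hFA : ∀ n, ∀ v ∈ ball (0 : EuclideanSpace ℂ (Fin k)) ε₀,
      ‖F n v - A n v‖ ≤ C * ‖v‖ ^ 2)
    (L : ℝ)
    (hL : L = limsup (fun N : ℕ => ⨆ n : ℕ, (1 / (N : ℝ)) * Real.log ‖prodCLM A n N‖) atTop)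
    (hLneg : L < 0) :
    ∀ δ : ℝ, 0 < δ → L + δ < 0 →
      ∃ ε : ℝ, 0 < ε ∧ ε < ε₀ ∧ ∃ C' : ℝ, 1 ≤ C' ∧
        ∀ (n : ℕ) (v : EuclideanSpace ℂ (Fin k)), ‖v‖ ≤ ε →
          ∀ N : ℕ,
            (∀ j ≤ N, seqComp F n j v ∈ ball (0 : EuclideanSpace ℂ (Fin k)) ε₀) ∧
            ‖seqComp F n N v‖ ≤ C' * Real.exp ((L + δ) * N) * ‖v‖ := by
  intro δ hδ hLδ
  obtain ⟨b, hbc, hev⟩ := exists_eventually_le_of_limsup_lt (hL ▸ hLneg)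
    (c := L + δ) (by linarith)
  obtain ⟨M, hMb, hM⟩ := (hev.and (eventually_gt_atTop 0)).exists
  set lam := L + δ
  have hP := fun n => norm_le_exp_of_iSup_le hM (hbc.trans hLδ) hMb n
  have hM' : (0 : ℝ) < M := Nat.cast_pos.2 hM
  set θ := Real.exp (M * (b - lam))
  have hθ : θ < 1 := Real.exp_lt_one_iff.2 (mul_neg_of_pos_of_neg hM' (by linarith))
  set K := ∑ j ∈ Finset.range M, Real.exp (-(lam * j)) * a ^ j
  have hK : 1 ≤ K := by
    have h := Finset.single_le_sum (f := fun j : ℕ => Real.exp (-(lam * j)) * a ^ j)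
      (fun j _ => by positivity) (Finset.mem_range.2 hM)
    simpa using h
  have hK0 : 0 < K := by linarith
  let r := min (ε₀ / 2) (Real.exp lam * (1 - θ) / (K * C))
  have hr0 : 0 < r := lt_min (by linarith)
    (div_pos (mul_pos (Real.exp_pos _) (by linarith)) (by positivity))
  have hrε : r < ε₀ := (min_le_left _ _).trans_lt (by linarith)
  have hrK : r * (K * C) ≤ Real.exp lam * (1 - θ) :=
    (le_div_iff₀ (by positivity)).1 (min_le_right _ _)
  have step : ∀ n v, ‖v‖ ≤ r → adaptedNorm A lam M (n + 1) (F n v) ≤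
      Real.exp lam * adaptedNorm A lam M n v := by
    intro n v hv
    have hball : v ∈ ball (0 : EuclideanSpace ℂ (Fin k)) ε₀ :=
      mem_ball_zero_iff.2 (hv.trans_lt hrε)
    have hsum := adaptedNorm_add_le A lam M (n + 1) (A n v) (F n v - A n v)
    rw [add_sub_cancel] at hsum
    have hlin := adaptedNorm_map_le (lam := lam) (hP n) v
    have herr : adaptedNorm A lam M (n + 1) (F n v - A n v) ≤
        Real.exp lam * (1 - θ) * ‖v‖ :=
      calc adaptedNorm A lam M (n + 1) (F n v - A n v) ≤ K * ‖F n v - A n v‖ :=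
            adaptedNorm_le hA lam M (n + 1) _
        _ ≤ K * (C * ‖v‖ ^ 2) := by gcongr; exact hFA n v hball
        _ = ‖v‖ * (K * C) * ‖v‖ := by ring
        _ ≤ r * (K * C) * ‖v‖ := by gcongr
        _ ≤ Real.exp lam * (1 - θ) * ‖v‖ := by gcongr
    linarith
  have key : ∀ n v, ‖v‖ ≤ r / K → ∀ N : ℕ,
      adaptedNorm A lam M (n + N) (seqComp F n N v) ≤ K * Real.exp (lam * N) * ‖v‖ ∧
        ‖seqComp F n N v‖ ≤ r := by
    intro n v hv N
    have small : ∀ N : ℕ,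
        adaptedNorm A lam M (n + N) (seqComp F n N v) ≤ K * Real.exp (lam * N) * ‖v‖ →
          ‖seqComp F n N v‖ ≤ r := by
      intro N h
      have hexp : Real.exp (lam * N) ≤ 1 :=
        Real.exp_le_one_iff.2 (mul_nonpos_of_nonpos_of_nonneg hLδ.le N.cast_nonneg)
      calc ‖seqComp F n N v‖ ≤ K * Real.exp (lam * N) * ‖v‖ :=
            (norm_le_adaptedNorm A lam hM _ _).trans h
        _ ≤ K * 1 * (r / K) := by gcongr
        _ = r := by field_simp
    have bound : adaptedNorm A lam M (n + N) (seqComp F n N v) ≤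
        K * Real.exp (lam * N) * ‖v‖ := by
      induction N with
      | zero => simpa [seqComp] using adaptedNorm_le hA lam M n v
      | succ N ih =>
        calc adaptedNorm A lam M (n + (N + 1)) (seqComp F n (N + 1) v)
            ≤ Real.exp lam * adaptedNorm A lam M (n + N) (seqComp F n N v) :=
              step (n + N) _ (small N ih)
          _ ≤ Real.exp lam * (K * Real.exp (lam * N) * ‖v‖) := by gcongr
          _ = K * Real.exp (lam * (N + 1 : ℕ)) * ‖v‖ := by
              push_cast
              rw [mul_add, mul_one, Real.exp_add (lam * N)]
              ring
    exact ⟨bound, small N bound⟩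
  refine ⟨r / K, div_pos hr0 hK0, (div_le_self hr0.le hK).trans_lt hrε, K, hK, ?_⟩
  intro n v hv N
  exact ⟨fun j _ => mem_ball_zero_iff.2 ((key n v hv j).2.trans_lt hrε),
    (norm_le_adaptedNorm A lam hM _ _).trans (key n v hv N).1⟩
end
end

section
/- Let k ≥ 1 and B ≥ 2, and let T(v) = v + Σ_{j=2}^∞ T_j(v), where each T_j : ℂ^k → ℂ^k is a homogeneous polynomial map of degree j with ‖T_j‖ ≤ B^j (so that T is a well-defined analytic map on B(0, 1/B)). Then |T(v)| ≥ |v|/3 for every v with |v| ≤ 1/(2B²), and the image T(B(0, 1/(2B²))) contains the ball B(0, 1/(12B²)). -/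
open Metric

noncomputable section

/-- `Φ` is a homogeneous polynomial map of degree `d`: it is the restriction to the
diagonal of a continuous multilinear map. -/
def IsHomPolyMap {E F : Type*} [NormedAddCommGroup E] [NormedSpace ℂ E]
    [NormedAddCommGroup F] [NormedSpace ℂ F] (d : ℕ) (Φ : E → F) : Prop :=
  ∃ M : ContinuousMultilinearMap ℂ (fun _ : Fin d => E) F, ∀ v, Φ v = M (fun _ => v)

/-- Geometric majorant for the terms of a series whose degree `j + 2` part is bounded by
`B ^ (j + 2)`. -/
lemma pow_mul_pow_le_geometric {B x : ℝ} (hB : 2 ≤ B) (hx0 : 0 ≤ x) (hx : x ≤ 1 / (2 * B ^ 2))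
    (j : ℕ) : B ^ (j + 2) * x ^ (j + 2) ≤ B ^ 2 * x ^ 2 * (1 / 4) ^ j := by
  have hBpos : 0 < B := by linarith
  have hBx : B * x ≤ 1 / 4 := by
    rw [le_div_iff₀ (by positivity)] at hx
    nlinarith [mul_nonneg hBpos.le hx0]
  calc B ^ (j + 2) * x ^ (j + 2) = B ^ 2 * x ^ 2 * (B * x) ^ j := by ring
    _ ≤ B ^ 2 * x ^ 2 * (1 / 4) ^ j := by gcongr

lemma norm_tsum_le_of_norm_le_geometric {E : Type*} [NormedAddCommGroup E]
    {B : ℝ} (hB : 2 ≤ B) {f : ℕ → E → E}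
    (hf : ∀ j v, ‖f j v‖ ≤ B ^ (j + 2) * ‖v‖ ^ (j + 2)) {v : E} (hv : ‖v‖ ≤ 1 / (2 * B ^ 2)) :
    ‖∑' j, f j v‖ ≤ 4 / 3 * (B ^ 2 * ‖v‖ ^ 2) := by
  have hg : HasSum (fun j : ℕ => B ^ 2 * ‖v‖ ^ 2 * (1 / 4 : ℝ) ^ j)
      (B ^ 2 * ‖v‖ ^ 2 * (1 - 1 / 4)⁻¹) :=
    (hasSum_geometric_of_lt_one (by norm_num) (by norm_num)).mul_left _
  have h := tsum_of_norm_bounded hg fun j =>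
    (hf j v).trans (pow_mul_pow_le_geometric hB (norm_nonneg v) hv j)
  refine h.trans (le_of_eq ?_)
  norm_num
  ring

lemma IsHomPolyMap.differentiable {E F : Type*} [NormedAddCommGroup E] [NormedSpace ℂ E]
    [NormedAddCommGroup F] [NormedSpace ℂ F] {d : ℕ} {Φ : E → F} (h : IsHomPolyMap d Φ) :
    Differentiable ℂ Φ := by
  obtain ⟨M, hM⟩ := h
  obtain rfl : Φ = fun v => M fun _ => v := funext hM
  have hd : Differentiable ℂ M := (M.contDiff (n := 1)).differentiable (by norm_num)
  exact hd.comp (differentiable_pi.2 fun _ => differentiable_id)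

/-- The sum of the higher order terms is a contraction near the origin. -/
lemma dist_tsum_le_of_isHomPolyMap {E : Type*} [NormedAddCommGroup E] [NormedSpace ℂ E]
    [CompleteSpace E] {B : ℝ} (hB : 2 ≤ B) {f : ℕ → E → E} (hhom : ∀ j, IsHomPolyMap (j + 2) (f j))
    (hf : ∀ j v, ‖f j v‖ ≤ B ^ (j + 2) * ‖v‖ ^ (j + 2)) {v w : E}
    (hv : ‖v‖ ≤ 1 / (10 * B ^ 2)) (hw : ‖w‖ ≤ 1 / (10 * B ^ 2)) :
    dist (∑' j, f j v) (∑' j, f j w) ≤ 3 / 4 * dist v w := by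
  rcases eq_or_ne v w with rfl | hne
  · simp
  have hBpos : 0 < B := by linarith
  have hq : 0 < 1 / B ^ 2 := by positivity
  set q := 1 / B ^ 2 with hqdef
  have hBq : B ^ 2 * q = 1 := by rw [hqdef]; field_simp
  have h10 : 1 / (10 * B ^ 2) = q / 10 := by rw [hqdef]; field_simp
  have h2 : 1 / (2 * B ^ 2) = q / 2 := by rw [hqdef]; field_simp
  rw [h10] at hv hw
  have hd : 0 < ‖v - w‖ := norm_pos_iff.2 (sub_ne_zero.2 hne)
  have hd' : ‖v - w‖ ≤ q / 5 := (norm_sub_le v w).trans (by linarith)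
  set S := q / 4 / ‖v - w‖ with hS
  have hSd : S * ‖v - w‖ = q / 4 := by rw [hS]; field_simp
  have hSpos : 0 < S := by positivity
  set L : ℂ → E := fun z => w + z • (v - w) with hL
  have hLdiff : Differentiable ℂ L := by rw [hL]; fun_prop
  have hLnorm : ∀ z ∈ ball (0 : ℂ) S, ‖L z‖ ≤ 7 / 20 * q := by
    intro z hz
    rw [mem_ball_zero_iff] at hz
    calc ‖L z‖ ≤ ‖w‖ + ‖z‖ * ‖v - w‖ := (norm_add_le _ _).trans (by rw [norm_smul])
      _ ≤ q / 10 + S * ‖v - w‖ := by gcongr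
      _ = 7 / 20 * q := by rw [hSd]; ring
  have hbound : ∀ (u : E) (c : ℝ), c ≤ 1 / 2 → ‖u‖ ≤ c * q →
      ‖∑' j, f j u‖ ≤ 4 / 3 * c ^ 2 * q := by
    intro u c hc hu
    have hu2 : ‖u‖ ≤ 1 / (2 * B ^ 2) := by rw [h2]; nlinarith
    calc ‖∑' j, f j u‖ ≤ 4 / 3 * (B ^ 2 * ‖u‖ ^ 2) :=
          norm_tsum_le_of_norm_le_geometric hB hf hu2
      _ ≤ 4 / 3 * (B ^ 2 * (c * q) ^ 2) := by gcongr
      _ = 4 / 3 * c ^ 2 * q * (B ^ 2 * q) := by ring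
      _ = 4 / 3 * c ^ 2 * q := by rw [hBq, mul_one]
  set g : ℂ → E := fun z => ∑' j, f j (L z) with hg
  have hgdiff : DifferentiableOn ℂ g (ball 0 S) := by
    refine Complex.differentiableOn_tsum_of_summable_norm
      (u := fun j : ℕ => B ^ 2 * (7 / 20 * q) ^ 2 * (1 / 4 : ℝ) ^ j)
      ((summable_geometric_of_lt_one (by norm_num) (by norm_num)).mul_left _)
      (fun j => ((hhom j).differentiable.comp hLdiff).differentiableOn) isOpen_ball ?_
    intro j z hz
    have hz' := hLnorm z hz
    calc ‖f j (L z)‖ ≤ B ^ (j + 2) * ‖L z‖ ^ (j + 2) := hf j _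
      _ ≤ B ^ (j + 2) * (7 / 20 * q) ^ (j + 2) := by gcongr
      _ ≤ _ := pow_mul_pow_le_geometric hB (by positivity) (by rw [h2]; linarith) j
  have hg0 : g 0 = ∑' j, f j w := by simp [hg, hL]
  have hg1 : g 1 = ∑' j, f j v := by simp [hg, hL]
  have hmaps : Set.MapsTo g (ball 0 S) (closedBall (g 0) (3 / 16 * q)) := by
    intro z hz
    have h1 := hbound (L z) (7 / 20) (by norm_num) (hLnorm z hz)
    have h0 := hbound w (1 / 10) (by norm_num) (by linarith)
    rw [mem_closedBall, dist_eq_norm, hg0]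
    exact (norm_sub_le _ _).trans (by linarith)
  have h1mem : (1 : ℂ) ∈ ball (0 : ℂ) S := by
    rw [mem_ball_zero_iff, norm_one, hS, one_lt_div hd]
    linarith
  have key := Complex.dist_le_div_mul_dist_of_mapsTo_ball hgdiff hmaps h1mem
  rw [hg0, hg1] at key
  refine key.trans (le_of_eq ?_)
  rw [dist_zero_right, norm_one, mul_one, div_eq_iff hSpos.ne', dist_eq_norm, mul_assoc,
    mul_comm ‖v - w‖, hSd]
  ring

/-- Let `k ≥ 1`, `B ≥ 2` and `T(v) = v + Σ_{j=2}^∞ T_j(v)` where `T_j`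
is a homogeneous polynomial map of degree `j` with `‖T_j‖ ≤ B^j` (here the parts are
indexed by `T' j` of degree `j+2`).  Then `|T v| ≥ |v|/3` whenever `|v| ≤ 1/(2B²)`,
and the image `T(B(0, 1/(2B²)))` contains the ball `B(0, 1/(12B²))`. -/
theorem stmt9 (k : ℕ) (hk : 1 ≤ k) (B : ℝ) (hB : 2 ≤ B)
    (T' : ℕ → EuclideanSpace ℂ (Fin k) → EuclideanSpace ℂ (Fin k))
    (hhom : ∀ j, IsHomPolyMap (j + 2) (T' j))
    (hbd : ∀ j v, ‖T' j v‖ ≤ B ^ (j + 2) * ‖v‖ ^ (j + 2)) :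
    (∀ v : EuclideanSpace ℂ (Fin k), ‖v‖ ≤ 1 / (2 * B ^ 2) →
      ‖v‖ / 3 ≤ ‖v + ∑' j : ℕ, T' j v‖) ∧
    ball (0 : EuclideanSpace ℂ (Fin k)) (1 / (12 * B ^ 2)) ⊆
      (fun v => v + ∑' j : ℕ, T' j v) '' ball (0 : EuclideanSpace ℂ (Fin k)) (1 / (2 * B ^ 2)) := by
  have hBpos : 0 < B := by linarith
  constructor
  · intro v hv
    have h1 := norm_tsum_le_of_norm_le_geometric hB hbd hv
    have h2 := norm_sub_le (v + ∑' j : ℕ, T' j v) (∑' j : ℕ, T' j v)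
    rw [add_sub_cancel_right] at h2
    rw [le_div_iff₀ (by positivity)] at hv
    have h3 : B ^ 2 * ‖v‖ ^ 2 ≤ ‖v‖ / 2 := by nlinarith [norm_nonneg v]
    linarith
  · intro w hw
    rw [mem_ball_zero_iff] at hw
    have hq : 0 < 1 / B ^ 2 := by positivity
    set q := 1 / B ^ 2 with hqdef
    have hBq : B ^ 2 * q = 1 := by rw [hqdef]; field_simp
    have h10 : 1 / (10 * B ^ 2) = q / 10 := by rw [hqdef]; field_simp
    have h2 : 1 / (2 * B ^ 2) = q / 2 := by rw [hqdef]; field_simp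
    have h12 : 1 / (12 * B ^ 2) = q / 12 := by rw [hqdef]; field_simp
    rw [h12] at hw
    set s := closedBall (0 : EuclideanSpace ℂ (Fin k)) (q / 10)
    have hmaps : Set.MapsTo (fun v => w - ∑' j : ℕ, T' j v) s s := by
      intro v hv
      rw [mem_closedBall_zero_iff] at hv ⊢
      have h1 := norm_tsum_le_of_norm_le_geometric hB hbd (v := v) (by rw [h2]; linarith)
      have h3 : B ^ 2 * ‖v‖ ^ 2 ≤ q / 100 := by
        calc B ^ 2 * ‖v‖ ^ 2 ≤ B ^ 2 * (q / 10) ^ 2 := by gcongr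
          _ = B ^ 2 * q * (q / 100) := by ring
          _ = q / 100 := by rw [hBq, one_mul]
      exact (norm_sub_le _ _).trans (by linarith)
    have hcontr : ContractingWith (3 / 4) (hmaps.restrict _ s s) := by
      refine ⟨?_, LipschitzWith.of_dist_le_mul fun x y => ?_⟩
      · rw [← NNReal.coe_lt_coe]
        norm_num
      · have hx := mem_closedBall_zero_iff.1 x.2
        have hy := mem_closedBall_zero_iff.1 y.2
        have h := dist_tsum_le_of_isHomPolyMap hB hhom hbd (hx.trans h10.ge) (hy.trans h10.ge)
        exact (dist_sub_left w _ _).trans_le h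
    have h0s : (0 : EuclideanSpace ℂ (Fin k)) ∈ s := mem_closedBall_self (by positivity)
    obtain ⟨v, hvs, hv, -⟩ := hcontr.exists_fixedPoint' isClosed_closedBall.isComplete hmaps h0s
      (edist_ne_top _ _)
    refine ⟨v, ?_, ?_⟩
    · rw [mem_closedBall_zero_iff] at hvs
      rw [mem_ball_zero_iff, h2]
      linarith
    · have hv' : w - ∑' j : ℕ, T' j v = v := hv
      exact (sub_eq_iff_eq_add.1 hv').symm
end
end
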